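/- arXiv:0907.2348 — 2 statements merged into one kernel-verified Lean document; each statement's English description precedes it below -/
import Mathlib

section
/- Let f(z) = ((1+z)e^{−z} − 1)/(4π z²) for z > 0, and define Φ : ℝ³ \ {0} → ℝ³ by Φ(x) = f(|x|) x/|x|. Then Φ is differentiable on ℝ³ \ {0} and there is a constant C > 0 such that for every x ≠ 0 the operator norm of its derivative satisfies ‖DΦ(x)‖ ≤ C (1 + 1/|x|). -/
noncomputable section

abbrev E3 := EuclideanSpace ℝ (Fin 3)

/-- The kernel profile `f(z) = ((1+z)e^{-z} - 1)/(4 π z²)`. -/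
def kf (z : ℝ) : ℝ := ((1 + z) * Real.exp (-z) - 1) / (4 * Real.pi * z ^ 2)

/-- The Biot–Savart-type kernel `Φ(x) = f(|x|) x/|x|` (for `α = 1`). -/
def Phi (x : E3) : E3 := kf ‖x‖ • (‖x‖⁻¹ • x)

/-- The elementary bound `|(1+r)e^{-r} - 1| ≤ r²` for `r > 0`. -/
lemma abs_one_add_mul_exp_neg_sub_one_le {r : ℝ} (hr : 0 < r) :
    |(1 + r) * Real.exp (-r) - 1| ≤ r ^ 2 := by
  have h1 : 1 - r ≤ Real.exp (-r) := Real.one_sub_le_exp_neg r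
  have h2 : (1 + r) * Real.exp (-r) ≤ Real.exp r * Real.exp (-r) := by
    gcongr
    linarith [Real.add_one_le_exp r]
  rw [← Real.exp_add, add_neg_cancel, Real.exp_zero] at h2
  rw [abs_le]
  constructor <;> nlinarith

/-- The radial multiplier `f(r)/r`, so that `Φ(x) = kfDiv |x| • x`. -/
def kfDiv (r : ℝ) : ℝ := ((1 + r) * Real.exp (-r) - 1) / (4 * Real.pi * r ^ 3)

lemma Phi_eq_kfDiv_smul : Phi = fun x => kfDiv ‖x‖ • x := by
  funext x
  rw [Phi, smul_smul, kf, kfDiv]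
  congr 1
  rw [← div_eq_mul_inv, div_div]
  ring_nf

lemma hasDerivAt_kfDiv {r : ℝ} (hr : 0 < r) :
    HasDerivAt kfDiv
      (-(Real.exp (-r) / r ^ 2 + 3 * ((1 + r) * Real.exp (-r) - 1) / r ^ 4) / (4 * Real.pi)) r := by
  have hpi := Real.pi_pos
  have hnum : HasDerivAt (fun r : ℝ => (1 + r) * Real.exp (-r) - 1)
      (1 * Real.exp (-r) + (1 + r) * (Real.exp (-r) * (-1))) r :=
    (((hasDerivAt_id r).const_add 1).mul (hasDerivAt_neg r).exp).sub_const 1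
  have hden : HasDerivAt (fun r : ℝ => 4 * Real.pi * r ^ 3)
      (4 * Real.pi * (3 * r ^ 2)) r := by
    simpa using (hasDerivAt_pow 3 r).const_mul (4 * Real.pi)
  refine (hnum.fun_div hden (by positivity)).congr_deriv ?_
  field_simp
  ring

lemma abs_kfDiv_le {r : ℝ} (hr : 0 < r) : |kfDiv r| ≤ 1 / (4 * Real.pi) * (1 / r) := by
  have hpi := Real.pi_pos
  rw [kfDiv, abs_div, abs_of_pos (by positivity : 0 < 4 * Real.pi * r ^ 3)]
  calc _ ≤ r ^ 2 / (4 * Real.pi * r ^ 3) := by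
        gcongr
        exact abs_one_add_mul_exp_neg_sub_one_le hr
    _ = _ := by field_simp

lemma abs_deriv_kfDiv_mul_le {r : ℝ} (hr : 0 < r) :
    |deriv kfDiv r| * r ≤ 4 / (4 * Real.pi) * (1 / r) := by
  have hpi := Real.pi_pos
  have hexp : Real.exp (-r) ≤ 1 := Real.exp_le_one_iff.2 (by linarith)
  rw [(hasDerivAt_kfDiv hr).deriv, abs_div, abs_neg,
    abs_of_pos (by positivity : 0 < 4 * Real.pi)]
  have h : |Real.exp (-r) / r ^ 2 + 3 * ((1 + r) * Real.exp (-r) - 1) / r ^ 4| ≤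
      1 / r ^ 2 + 3 * r ^ 2 / r ^ 4 := by
    refine (abs_add_le _ _).trans (add_le_add ?_ ?_)
    · rw [abs_of_pos (by positivity)]
      gcongr
    · rw [abs_div, abs_mul, abs_of_pos (by positivity : 0 < r ^ 4),
        abs_of_pos (by norm_num : (0 : ℝ) < 3)]
      gcongr
      exact abs_one_add_mul_exp_neg_sub_one_le hr
  calc _ ≤ (1 / r ^ 2 + 3 * r ^ 2 / r ^ 4) / (4 * Real.pi) * r := by gcongr
    _ = _ := by
      field_simp
      norm_num

lemma hasFDerivAt_Phi {x : E3} (hx : x ≠ 0) :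
    HasFDerivAt Phi (kfDiv ‖x‖ • ContinuousLinearMap.id ℝ E3 +
      (deriv kfDiv ‖x‖ • fderiv ℝ (fun y : E3 => ‖y‖) x).smulRight x) x := by
  have hnorm : HasFDerivAt (fun y : E3 => ‖y‖) (fderiv ℝ (fun y : E3 => ‖y‖) x) x :=
    ((contDiffAt_norm ℝ hx).differentiableAt one_ne_zero).hasFDerivAt
  have hd := (hasDerivAt_kfDiv (norm_pos_iff.2 hx)).differentiableAt.hasDerivAt
  rw [Phi_eq_kfDiv_smul]
  exact (hd.comp_hasFDerivAt x hnorm).smul (hasFDerivAt_id x)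

lemma norm_fderiv_Phi_le {x : E3} (hx : x ≠ 0) : ‖fderiv ℝ Phi x‖ ≤ 1 / ‖x‖ := by
  have hr := norm_pos_iff.2 hx
  have hD : ‖fderiv ℝ (fun y : E3 => ‖y‖) x‖ ≤ 1 := by
    simpa using norm_fderiv_le_of_lipschitz ℝ (lipschitzWith_one_norm (E := E3)) (x₀ := x)
  rw [(hasFDerivAt_Phi hx).fderiv]
  calc _ ≤ |kfDiv ‖x‖| * 1 + |deriv kfDiv ‖x‖| * 1 * ‖x‖ := by
        refine (norm_add_le _ _).trans (add_le_add ?_ ?_)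
        · rw [norm_smul, Real.norm_eq_abs]
          gcongr
          exact ContinuousLinearMap.norm_id_le
        · rw [ContinuousLinearMap.norm_smulRight_apply, norm_smul, Real.norm_eq_abs]
          gcongr
    _ ≤ 1 / (4 * Real.pi) * (1 / ‖x‖) + 4 / (4 * Real.pi) * (1 / ‖x‖) := by
        rw [mul_one, mul_one]
        exact add_le_add (abs_kfDiv_le hr) (abs_deriv_kfDiv_mul_le hr)
    _ = 5 / (4 * Real.pi) * (1 / ‖x‖) := by ring
    _ ≤ 1 * (1 / ‖x‖) := by
        gcongr
        rw [div_le_one (by positivity)]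
        linarith [Real.pi_gt_three]
    _ = _ := one_mul _

/-- `Φ` is differentiable away from the origin with `‖DΦ(x)‖ ≤ C(1 + 1/|x|)`. -/
theorem Phi_deriv_bound :
    (∀ x : E3, x ≠ 0 → DifferentiableAt ℝ Phi x) ∧
      ∃ C : ℝ, 0 < C ∧ ∀ x : E3, x ≠ 0 → ‖fderiv ℝ Phi x‖ ≤ C * (1 + 1 / ‖x‖) := by
  refine ⟨fun x hx => (hasFDerivAt_Phi hx).differentiableAt, 1, one_pos, fun x hx => ?_⟩
  linarith [norm_fderiv_Phi_le hx]

end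
end

section
/- Let α > 0, let χ : ℝ → [0,1] be smooth with χ(s) = 1 for |s| < 1 and χ(s) = 0 for |s| > 2. Let T : ℝ³ → ℝ³ be measurable, let ω ∈ L¹(ℝ³) have compact support, and suppose |T(z)| ≤ L for a.e. z in the support of ω. For i, j ∈ {1,2,3} define H₁(x) = ∫_{ℝ³} ∂_{x_j}∂_{x_i}[ f_α(|x − T(z)|) (x − T(z))/|x − T(z)| ] (1 − χ(|x − T(z)|)) × (T₂(z), −T₁(z), 0) ω(z) dz and H₂(x) = ∫_{ℝ³} ∂_{x_j}∂_{x_i}[ f_α(|x − T(z)|) (x − T(z))/|x − T(z)| ] χ(|x − T(z)|) × (T₂(z), −T₁(z), 0) ω(z) dz. Then there is a constant C, depending only on α, L and χ, such that ‖H₁‖_{L^∞(ℝ³)} ≤ C ‖ω‖_{L¹(ℝ³)}, and for every 1 ≤ b < 3/2 there is a constant C_b, depending only on α, b, L and χ, such that ‖H₂‖_{L^b(ℝ³)} ≤ C_b ‖ω‖_{L¹(ℝ³)}. -/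
open MeasureTheory

noncomputable section

/-- The rescaled profile `f_α(r) = α⁻² f(r/α)`. -/
def kfa (α r : ℝ) : ℝ := (α ^ 2)⁻¹ * kf (r / α)

/-- The cross product on `ℝ³` (with the Euclidean norm). -/
def cross3 (a b : E3) : E3 :=
  (WithLp.equiv 2 (Fin 3 → ℝ)).symm
    ![a 1 * b 2 - a 2 * b 1, a 2 * b 0 - a 0 * b 2, a 0 * b 1 - a 1 * b 0]

/-- The azimuthal vector `(w₂, -w₁, 0)` attached to `w ∈ ℝ³`. -/
def svec (w : E3) : E3 :=
  (WithLp.equiv 2 (Fin 3 → ℝ)).symm ![w 1, -(w 0), 0]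

/-- The Biot–Savart-type kernel `Φ_α(v) = f_α(|v|) v/|v|` (equal to `0` at `v = 0`). -/
def PhiA (α : ℝ) (v : E3) : E3 := kfa α ‖v‖ • (‖v‖⁻¹ • v)

/-- The second partial `∂_{x_j}∂_{x_i}[Φ_α(x - w)]`. -/
def secondPartialKer (α : ℝ) (w : E3) (i j : Fin 3) (x : E3) : E3 :=
  fderiv ℝ
    (fun y => fderiv ℝ (fun y' => PhiA α (y' - w)) y (EuclideanSpace.single i 1))
    x (EuclideanSpace.single j 1)

theorem HasDerivAt.hasFDerivAt_comp_norm {E : Type*} [NormedAddCommGroup E]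
    [InnerProductSpace ℝ E] {u : ℝ → ℝ} {u' : ℝ} {v : E} (hv : v ≠ 0)
    (hu : HasDerivAt u u' ‖v‖) :
    HasFDerivAt (fun y : E => u ‖y‖) ((u' / ‖v‖) • innerSL ℝ v) v := by
  have hn : ‖v‖ ≠ 0 := norm_ne_zero_iff.mpr hv
  have h1 : HasFDerivAt (fun y : E => √(‖y‖ ^ 2)) _ v :=
    (hasStrictFDerivAt_norm_sq v).hasFDerivAt.sqrt (pow_ne_zero 2 hn)
  simp only [Real.sqrt_sq (norm_nonneg _)] at h1
  refine HasFDerivAt.congr_fderiv (hu.comp_hasFDerivAt v h1) ?_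
  ext y
  simp
  field_simp

/-- `(1 + r/α) e^{-r/α} - 1`, the numerator of the Biot–Savart kernel. -/
def kernelNum (α r : ℝ) : ℝ := (1 + r / α) * Real.exp (-(r / α)) - 1

theorem abs_kernelNum_le {α r : ℝ} (hα : 0 < α) (hr : 0 ≤ r) :
    |kernelNum α r| ≤ r ^ 2 / α ^ 2 := by
  have ht : 0 ≤ r / α := by positivity
  rw [← div_pow, kernelNum]
  generalize r / α = t at ht
  have h1 : 1 - t ≤ Real.exp (-t) := Real.one_sub_le_exp_neg t
  have h2 : (1 + t) * Real.exp (-t) ≤ 1 := by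
    rw [Real.exp_neg, ← div_eq_mul_inv, div_le_one (Real.exp_pos t)]
    linarith [Real.add_one_le_exp t]
  rw [abs_le]
  constructor <;> nlinarith [sq_nonneg t]

theorem hasDerivAt_kernelNum {α : ℝ} (hα : 0 < α) (r : ℝ) :
    HasDerivAt (kernelNum α) (-(r / α ^ 2 * Real.exp (-(r / α)))) r := by
  have h1 : HasDerivAt (fun r : ℝ => r / α) (1 / α) r := (hasDerivAt_id r).div_const α
  refine (((h1.const_add 1).mul h1.neg.exp).sub_const 1).congr_deriv ?_
  simp only [Pi.neg_apply]
  field_simp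
  ring

/-- The profile `h` such that `PhiA α v = h ‖v‖ • v`. -/
def kernelProfile (α r : ℝ) : ℝ := kernelNum α r / (4 * Real.pi * r ^ 3)

/-- The function `h'(r) / r`, for `h = kernelProfile α`. -/
def kernelProfile₁ (α r : ℝ) : ℝ :=
  -(Real.exp (-(r / α)) / (4 * Real.pi * α ^ 2 * r ^ 3)) -
    3 * kernelNum α r / (4 * Real.pi * r ^ 5)

/-- The derivative of `kernelProfile₁ α`. -/
def kernelProfile₂ (α r : ℝ) : ℝ :=
  Real.exp (-(r / α)) / (4 * Real.pi * α ^ 3 * r ^ 3) +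
    6 * Real.exp (-(r / α)) / (4 * Real.pi * α ^ 2 * r ^ 4) +
    15 * kernelNum α r / (4 * Real.pi * r ^ 6)

theorem hasDerivAt_kernelProfile {α r : ℝ} (hα : 0 < α) (hr : 0 < r) :
    HasDerivAt (kernelProfile α) (r * kernelProfile₁ α r) r := by
  have hp : Real.pi ≠ 0 := Real.pi_ne_zero
  refine ((hasDerivAt_kernelNum hα r).div ((hasDerivAt_pow 3 r).const_mul (4 * Real.pi))
    (by positivity)).congr_deriv ?_
  rw [kernelProfile₁]
  field_simp
  push_cast
  ring

theorem hasDerivAt_kernelProfile₁ {α r : ℝ} (hα : 0 < α) (hr : 0 < r) :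
    HasDerivAt (kernelProfile₁ α) (kernelProfile₂ α r) r := by
  have hp : Real.pi ≠ 0 := Real.pi_ne_zero
  have h1 : HasDerivAt (fun r : ℝ => r / α) (1 / α) r := (hasDerivAt_id r).div_const α
  have h2 := h1.neg.exp.div ((hasDerivAt_pow 3 r).const_mul (4 * Real.pi * α ^ 2))
    (by positivity)
  have h3 := ((hasDerivAt_kernelNum hα r).const_mul 3).div
    ((hasDerivAt_pow 5 r).const_mul (4 * Real.pi)) (by positivity)
  refine (h2.neg.sub h3).congr_deriv ?_
  rw [kernelProfile₂]
  simp only [Pi.neg_apply]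
  field_simp
  push_cast
  ring

theorem abs_kernelProfile₁_le {α r : ℝ} (hα : 0 < α) (hr : 0 < r) :
    |kernelProfile₁ α r| ≤ 4 / α ^ 2 / r ^ 3 := by
  have hp : 1 ≤ 4 * Real.pi := by linarith [Real.pi_gt_three]
  have hE : Real.exp (-(r / α)) ≤ 1 := Real.exp_le_one_iff.mpr (by
    have : 0 ≤ r / α := by positivity
    linarith)
  have hN := abs_kernelNum_le hα hr.le
  calc |kernelProfile₁ α r|
      ≤ Real.exp (-(r / α)) / (4 * Real.pi * α ^ 2 * r ^ 3) +
        3 * |kernelNum α r| / (4 * Real.pi * r ^ 5) := by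
        rw [kernelProfile₁]
        refine (abs_sub _ _).trans (le_of_eq ?_)
        rw [abs_neg, abs_div, abs_div, abs_mul 3, Real.abs_exp,
          abs_of_pos (show 0 < 4 * Real.pi * α ^ 2 * r ^ 3 by positivity),
          abs_of_pos (show 0 < 4 * Real.pi * r ^ 5 by positivity),
          abs_of_pos (show (0 : ℝ) < 3 by norm_num)]
    _ ≤ 1 / (1 * α ^ 2 * r ^ 3) + 3 * (r ^ 2 / α ^ 2) / (1 * r ^ 5) := by gcongr
    _ = 4 / α ^ 2 / r ^ 3 := by field_simp; ring

theorem abs_kernelProfile₂_le {α r : ℝ} (hα : 0 < α) (hr : 0 < r) :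
    |kernelProfile₂ α r| ≤ 22 / α ^ 2 / r ^ 4 := by
  have hp : 1 ≤ 4 * Real.pi := by linarith [Real.pi_gt_three]
  have ht : 0 < r / α := by positivity
  have hE : Real.exp (-(r / α)) ≤ 1 := Real.exp_le_one_iff.mpr (by linarith)
  have hE' : Real.exp (-(r / α)) ≤ α / r := by
    rw [Real.exp_neg, ← inv_div r α]
    exact inv_anti₀ ht (by linarith [Real.add_one_le_exp (r / α)])
  have hN := abs_kernelNum_le hα hr.le
  calc |kernelProfile₂ α r|
      ≤ Real.exp (-(r / α)) / (4 * Real.pi * α ^ 3 * r ^ 3) +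
        6 * Real.exp (-(r / α)) / (4 * Real.pi * α ^ 2 * r ^ 4) +
        15 * |kernelNum α r| / (4 * Real.pi * r ^ 6) := by
        rw [kernelProfile₂]
        refine (abs_add_three _ _ _).trans (le_of_eq ?_)
        rw [abs_div, abs_div, abs_div, abs_mul 6, abs_mul 15, Real.abs_exp,
          abs_of_pos (show 0 < 4 * Real.pi * α ^ 3 * r ^ 3 by positivity),
          abs_of_pos (show 0 < 4 * Real.pi * α ^ 2 * r ^ 4 by positivity),
          abs_of_pos (show 0 < 4 * Real.pi * r ^ 6 by positivity),
          abs_of_pos (show (0 : ℝ) < 6 by norm_num), abs_of_pos (show (0 : ℝ) < 15 by norm_num)]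
    _ ≤ α / r / (1 * α ^ 3 * r ^ 3) + 6 * 1 / (1 * α ^ 2 * r ^ 4) +
        15 * (r ^ 2 / α ^ 2) / (1 * r ^ 6) := by gcongr
    _ = 22 / α ^ 2 / r ^ 4 := by field_simp; ring

theorem PhiA_eq_kernelProfile_smul {α : ℝ} (hα : 0 < α) (v : E3) :
    PhiA α v = kernelProfile α ‖v‖ • v := by
  rcases eq_or_ne v 0 with rfl | hv
  · simp [PhiA]
  have hn : ‖v‖ ≠ 0 := norm_ne_zero_iff.mpr hv
  have hp : Real.pi ≠ 0 := Real.pi_ne_zero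
  rw [PhiA, smul_smul, kfa, kf, kernelProfile, kernelNum]
  congr 1
  field_simp

theorem hasFDerivAt_PhiA {α : ℝ} (hα : 0 < α) {v : E3} (hv : v ≠ 0) :
    HasFDerivAt (PhiA α) (kernelProfile α ‖v‖ • ContinuousLinearMap.id ℝ E3 +
      (kernelProfile₁ α ‖v‖ • innerSL ℝ v).smulRight v) v := by
  have hn : 0 < ‖v‖ := norm_pos_iff.mpr hv
  have h := ((hasDerivAt_kernelProfile hα hn).hasFDerivAt_comp_norm hv).smul (hasFDerivAt_id v)
  rw [mul_div_cancel_left₀ _ hn.ne'] at h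
  rw [show PhiA α = fun v => kernelProfile α ‖v‖ • v from
    funext (PhiA_eq_kernelProfile_smul hα)]
  exact h

theorem fderiv_PhiA_single {α : ℝ} (hα : 0 < α) {v : E3} (hv : v ≠ 0) (i : Fin 3) :
    fderiv ℝ (PhiA α) v (EuclideanSpace.single i 1) =
      kernelProfile α ‖v‖ • EuclideanSpace.single i 1 + (kernelProfile₁ α ‖v‖ * v i) • v := by
  rw [(hasFDerivAt_PhiA hα hv).fderiv]
  simp [EuclideanSpace.inner_single_right]

theorem secondPartialKer_eq {α : ℝ} (hα : 0 < α) {w x : E3} (h : x - w ≠ 0) (i j : Fin 3) :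
    secondPartialKer α w i j x =
      (kernelProfile₁ α ‖x - w‖ * (x - w) j) • EuclideanSpace.single i 1 +
      ((kernelProfile₁ α ‖x - w‖ * (x - w) i) • EuclideanSpace.single j 1 +
      (kernelProfile₁ α ‖x - w‖ * (EuclideanSpace.single j (1 : ℝ) : E3) i +
        (x - w) i * (kernelProfile₂ α ‖x - w‖ / ‖x - w‖ * (x - w) j)) • (x - w)) := by
  simp only [secondPartialKer, fderiv_comp_sub]
  rw [fderiv_comp_sub (f := fun y => fderiv ℝ (PhiA α) y (EuclideanSpace.single i 1))]
  generalize x - w = v at h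
  have hn : 0 < ‖v‖ := norm_pos_iff.mpr h
  have heq : (fun y => fderiv ℝ (PhiA α) y (EuclideanSpace.single i 1)) =ᶠ[nhds v]
      fun y => kernelProfile α ‖y‖ • EuclideanSpace.single i 1 +
        (kernelProfile₁ α ‖y‖ * y i) • y := by
    filter_upwards [isOpen_ne.mem_nhds h] with y hy using fderiv_PhiA_single hα hy i
  rw [heq.fderiv_eq]
  have h0 := (hasDerivAt_kernelProfile hα hn).hasFDerivAt_comp_norm h
  rw [mul_div_cancel_left₀ _ hn.ne'] at h0
  have h1 := (hasDerivAt_kernelProfile₁ hα hn).hasFDerivAt_comp_norm h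
  have hi : HasFDerivAt (fun y : E3 => y i) (EuclideanSpace.proj i : E3 →L[ℝ] ℝ) v :=
    (EuclideanSpace.proj i : E3 →L[ℝ] ℝ).hasFDerivAt
  have hF := (h0.smul_const (EuclideanSpace.single i (1 : ℝ) : E3)).add
    ((h1.mul hi).smul (hasFDerivAt_id v))
  have hF' : HasFDerivAt (fun y : E3 => kernelProfile α ‖y‖ • EuclideanSpace.single i (1 : ℝ) +
        (kernelProfile₁ α ‖y‖ * y i) • y) _ v := hF
  rw [hF'.fderiv]
  simp [EuclideanSpace.inner_single_right]

theorem norm_secondPartialKer_le {α : ℝ} (hα : 0 < α) {w x : E3} (h : x - w ≠ 0)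
    (i j : Fin 3) : ‖secondPartialKer α w i j x‖ ≤ 34 / α ^ 2 / ‖x - w‖ ^ 2 := by
  rw [secondPartialKer_eq hα h]
  generalize x - w = v at h
  have hn : 0 < ‖v‖ := norm_pos_iff.mpr h
  have hq := abs_kernelProfile₁_le hα hn
  have hd := abs_kernelProfile₂_le hα hn
  have hvi (k : Fin 3) : |v k| ≤ ‖v‖ := by simpa using PiLp.norm_apply_le v k
  have hδ : |(EuclideanSpace.single j (1 : ℝ) : E3) i| ≤ 1 := by
    simpa using PiLp.norm_apply_le (EuclideanSpace.single j (1 : ℝ) : E3) i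
  have hone (k : Fin 3) : ‖(EuclideanSpace.single k (1 : ℝ) : E3)‖ = 1 := by simp
  generalize EuclideanSpace.single j (1 : ℝ) i = d at hδ
  refine (norm_add_le _ _).trans ((add_le_add_right (norm_add_le _ _) _).trans ?_)
  simp only [norm_smul, Real.norm_eq_abs, hone, mul_one, abs_mul]
  calc _ ≤ |kernelProfile₁ α ‖v‖| * |v j| + (|kernelProfile₁ α ‖v‖| * |v i| +
        (|kernelProfile₁ α ‖v‖| * |d| +
          |v i| * (|kernelProfile₂ α ‖v‖| / ‖v‖ * |v j|)) * ‖v‖) := by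
        gcongr
        refine (abs_add_le _ _).trans (le_of_eq ?_)
        rw [abs_mul, abs_mul, abs_mul, abs_div, abs_norm]
    _ ≤ 4 / α ^ 2 / ‖v‖ ^ 3 * ‖v‖ + (4 / α ^ 2 / ‖v‖ ^ 3 * ‖v‖ +
        (4 / α ^ 2 / ‖v‖ ^ 3 * 1 +
          ‖v‖ * (22 / α ^ 2 / ‖v‖ ^ 4 / ‖v‖ * ‖v‖)) * ‖v‖) := by
        gcongr <;> exact hvi _
    _ = 34 / α ^ 2 / ‖v‖ ^ 2 := by field_simp; ring

theorem norm_svec_le (w : E3) : ‖svec w‖ ≤ ‖w‖ := by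
  rw [EuclideanSpace.norm_eq, EuclideanSpace.norm_eq]
  apply Real.sqrt_le_sqrt
  simp [svec, Fin.sum_univ_three]
  nlinarith [sq_nonneg (w 2)]

theorem norm_cross3_le (a b : E3) : ‖cross3 a b‖ ≤ ‖a‖ * ‖b‖ := by
  rw [EuclideanSpace.norm_eq, EuclideanSpace.norm_eq, EuclideanSpace.norm_eq,
    ← Real.sqrt_mul (by positivity)]
  apply Real.sqrt_le_sqrt
  simp [cross3, Fin.sum_univ_three]
  nlinarith [sq_nonneg (a 0 * b 0 + a 1 * b 1 + a 2 * b 2)]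

theorem norm_cross3_secondPartialKer_svec_le {α L : ℝ} (hα : 0 < α) {w x : E3}
    (h : x - w ≠ 0) (hw : ‖w‖ ≤ L) (i j : Fin 3) :
    ‖cross3 (secondPartialKer α w i j x) (svec w)‖ ≤ 34 / α ^ 2 * L / ‖x - w‖ ^ 2 := by
  calc _ ≤ ‖secondPartialKer α w i j x‖ * ‖svec w‖ := norm_cross3_le _ _
    _ ≤ 34 / α ^ 2 / ‖x - w‖ ^ 2 * L := by
      gcongr
      · exact norm_secondPartialKer_le hα h i j
      · exact (norm_svec_le w).trans hw
    _ = _ := by ring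

open Set in
theorem lintegral_near_kernel_lt_top {M b : ℝ} (hM : 0 ≤ M) (hb : 1 ≤ b) (hb' : b < 3 / 2) :
    ∫⁻ v : E3, (Metric.ball (0 : E3) 3).indicator
      (fun v => ENNReal.ofReal M / ‖v‖ₑ ^ 2) v ^ b < ⊤ := by
  have hb0 : 0 < b := by linarith
  have hI : IntegrableOn (fun v : E3 => (M / ‖v‖ ^ 2) ^ b) (Metric.ball 0 3) := by
    rw [integrableOn_fun_norm_addHaar volume (f := fun r => (M / r ^ 2) ^ b)]
    have h1 : IntegrableOn (fun r : ℝ => M ^ b * r ^ (2 - 2 * b)) (Ioo 0 3) :=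
      ((intervalIntegral.integrableOn_Ioo_rpow_iff (by norm_num)).mpr (by linarith)).const_mul _
    refine h1.congr_fun (fun r hr => ?_) measurableSet_Ioo
    have hr : 0 < r := hr.1
    simp only [finrank_euclideanSpace, Fintype.card_fin, smul_eq_mul]
    rw [Real.div_rpow hM (by positivity), Real.rpow_sub hr, Real.rpow_mul hr.le,
      Real.rpow_two]
    norm_num
    ring
  have hne : ∀ᵐ v : E3, v ≠ 0 := by simp [ae_iff]
  calc _ = ∫⁻ v in Metric.ball (0 : E3) 3, ‖(M / ‖v‖ ^ 2) ^ b‖ₑ := by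
        rw [← lintegral_indicator Metric.isOpen_ball.measurableSet]
        refine lintegral_congr_ae ?_
        filter_upwards [hne] with v hv
        have hn : 0 < ‖v‖ := norm_pos_iff.mpr hv
        by_cases hm : v ∈ Metric.ball (0 : E3) 3
        · rw [indicator_of_mem hm, indicator_of_mem hm, Real.enorm_of_nonneg (by positivity),
            ← ENNReal.ofReal_rpow_of_nonneg (by positivity) hb0.le,
            ENNReal.ofReal_div_of_pos (by positivity), ENNReal.ofReal_pow hn.le,
            ofReal_norm]
        · rw [indicator_of_notMem hm, indicator_of_notMem hm, ENNReal.zero_rpow_of_pos hb0]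
    _ < ⊤ := hI.2

/-- **Minkowski's integral inequality** for a translation kernel: averaging translates of `k`
against a weight `g` multiplies the `L^b` norm by at most the mass of `g`. -/
theorem lintegral_lintegral_mul_translate_rpow_le {E Z : Type*} [MeasurableSpace Z]
    [MeasurableSpace E] [AddGroup E] [MeasurableAdd E] [MeasurableSub₂ E]
    (μ : Measure Z) (ν : Measure E) [SFinite μ] [SFinite ν] [ν.IsAddRightInvariant]
    {b : ℝ} (hb : 1 ≤ b) {k : E → ENNReal} (hk : Measurable k) {T : Z → E} (hT : Measurable T)
    {g : Z → ENNReal} (hg : AEMeasurable g μ) :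
    (∫⁻ x, (∫⁻ z, g z * k (x - T z) ∂μ) ^ b ∂ν) ^ (1 / b) ≤
      (∫⁻ z, g z ∂μ) * (∫⁻ v, k v ^ b ∂ν) ^ (1 / b) := by
  have hb0 : 0 < b := by linarith
  set A := ∫⁻ z, g z ∂μ with hA
  have hk2 : Measurable fun q : E × Z => k (q.1 - T q.2) :=
    hk.comp (measurable_fst.sub (hT.comp measurable_snd))
  have hkx (x : E) : Measurable fun z => k (x - T z) := hk2.comp measurable_prodMk_left
  have hJ (x : E) : (∫⁻ z, g z * k (x - T z) ∂μ) ^ b ≤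
      A ^ (b - 1) * ∫⁻ z, g z * k (x - T z) ^ b ∂μ := by
    have h := eLpNorm'_le_eLpNorm'_mul_rpow_measure_univ (μ := μ.withDensity g) one_pos hb
      (hkx x).aestronglyMeasurable
    have h1 (F : Z → ENNReal) (hF : Measurable F) :
        ∫⁻ z, F z ∂μ.withDensity g = ∫⁻ z, g z * F z ∂μ :=
      lintegral_withDensity_eq_lintegral_mul₀ hg hF.aemeasurable
    simp only [eLpNorm', enorm_eq_self, ENNReal.rpow_one, div_one, withDensity_apply _
      MeasurableSet.univ, Measure.restrict_univ] at h
    rw [h1 _ (hkx x), h1 _ ((hkx x).pow_const b)] at h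
    calc _ ≤ _ := ENNReal.rpow_le_rpow h hb0.le
      _ = _ := by
        rw [ENNReal.mul_rpow_of_nonneg _ _ hb0.le, ← ENNReal.rpow_mul, ← ENNReal.rpow_mul,
          one_div_mul_cancel hb0.ne', ENNReal.rpow_one, mul_comm, sub_mul,
          one_div_mul_cancel hb0.ne', one_mul]
  have hm : AEMeasurable (Function.uncurry fun x z => g z * k (x - T z) ^ b) (ν.prod μ) :=
    hg.comp_snd.mul (hk2.pow_const b).aemeasurable
  have hF : ∫⁻ x, ∫⁻ z, g z * k (x - T z) ^ b ∂μ ∂ν = A * ∫⁻ v, k v ^ b ∂ν := by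
    rw [lintegral_lintegral_swap hm, hA, ← lintegral_mul_const'' _ hg]
    refine lintegral_congr fun z => ?_
    have hkz : Measurable fun x => k (x - T z) ^ b :=
      (hk2.comp measurable_prodMk_right).pow_const b
    rw [lintegral_const_mul _ hkz]
    congr 1
    exact lintegral_sub_right_eq_self (fun v => k v ^ b) (T z)
  have hAb : A ^ (b - 1) * A = A ^ b := by
    nth_rw 2 [← ENNReal.rpow_one A]
    rw [← ENNReal.rpow_add_of_nonneg _ _ (by linarith) zero_le_one, sub_add_cancel]
  calc _ ≤ (A ^ (b - 1) * (A * ∫⁻ v, k v ^ b ∂ν)) ^ (1 / b) := by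
        refine ENNReal.rpow_le_rpow ?_ (by positivity)
        refine (lintegral_mono hJ).trans ?_
        rw [← hF]
        exact (lintegral_const_mul'' _ hm.lintegral_prod_right').le
    _ = _ := by
        rw [← mul_assoc, hAb, ENNReal.mul_rpow_of_nonneg _ _ (by positivity),
          ← ENNReal.rpow_mul, mul_one_div_cancel hb0.ne', ENNReal.rpow_one]

/-- Far/near decomposition of the Hessian of the velocity: the far part `H₁`
(cutoff `1 - χ`) is bounded by `C ‖ω‖_{L¹}`, and the near part `H₂` (cutoff `χ`)
has `L^b` norm at most `C_b ‖ω‖_{L¹}` for every `1 ≤ b < 3/2`. -/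
theorem hessian_velocity_decomposition (α L : ℝ) (hα : 0 < α) (hL : 0 < L)
    (χ : ℝ → ℝ) (hχ : ContDiff ℝ (⊤ : ℕ∞) χ) (hχ01 : ∀ s, χ s ∈ Set.Icc (0 : ℝ) 1)
    (hχ1 : ∀ s : ℝ, |s| < 1 → χ s = 1) (hχ0 : ∀ s : ℝ, 2 < |s| → χ s = 0) :
    (∃ C : ℝ, 0 < C ∧
      ∀ (T : E3 → E3), Measurable T →
        ∀ ω : E3 → ℝ, Integrable ω → HasCompactSupport ω →
          (∀ᵐ z : E3, z ∈ Function.support ω → ‖T z‖ ≤ L) →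
          ∀ (i j : Fin 3) (x : E3),
            ‖∫ z : E3, ω z •
                ((1 - χ ‖x - T z‖) •
                  cross3 (secondPartialKer α (T z) i j x) (svec (T z)))‖ ≤
              C * ∫ z : E3, |ω z|) ∧
    ∀ b : ℝ, 1 ≤ b → b < 3 / 2 →
      ∃ Cb : ℝ, 0 < Cb ∧
        ∀ (T : E3 → E3), Measurable T →
          ∀ ω : E3 → ℝ, Integrable ω → HasCompactSupport ω →
            (∀ᵐ z : E3, z ∈ Function.support ω → ‖T z‖ ≤ L) →
            ∀ i j : Fin 3,
              eLpNorm
                (fun x : E3 => ∫ z : E3, ω z •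
                  (χ ‖x - T z‖ •
                    cross3 (secondPartialKer α (T z) i j x) (svec (T z))))
                (ENNReal.ofReal b) volume ≤
              ENNReal.ofReal (Cb * ∫ z : E3, |ω z|) := by
  have hM : 0 < 34 / α ^ 2 * L := by positivity
  refine ⟨⟨34 / α ^ 2 * L, hM, ?_⟩, ?_⟩
  · intro T _ ω hω _ hTL i j x
    rw [← integral_const_mul]
    refine norm_integral_le_of_norm_le (hω.abs.const_mul _) ?_
    filter_upwards [hTL] with z hz
    by_cases h0 : ω z = 0
    · simp [h0]
    by_cases hx : ‖x - T z‖ < 1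
    · rw [hχ1 _ (by rwa [abs_norm])]
      simp only [sub_self, zero_smul, smul_zero, norm_zero]
      positivity
    push Not at hx
    have hne : x - T z ≠ 0 := norm_pos_iff.mp (by linarith)
    rw [norm_smul, norm_smul, Real.norm_eq_abs, Real.norm_eq_abs, mul_comm]
    refine mul_le_mul_of_nonneg_right ?_ (abs_nonneg _)
    obtain ⟨hc0, hc1⟩ := hχ01 ‖x - T z‖
    calc _ ≤ 1 * (34 / α ^ 2 * L / ‖x - T z‖ ^ 2) := by
          gcongr
          · rw [abs_le]; constructor <;> linarith
          · exact norm_cross3_secondPartialKer_svec_le hα hne (hz h0) i j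
      _ ≤ 34 / α ^ 2 * L := by
          rw [one_mul]
          exact div_le_self hM.le (one_le_pow₀ hx)
  · intro b hb hb'
    have hb0 : 0 < b := by linarith
    set k : E3 → ENNReal := (Metric.ball (0 : E3) 3).indicator
      (fun v => ENNReal.ofReal (34 / α ^ 2 * L) / ‖v‖ₑ ^ 2) with hk
    have hkm : Measurable k :=
      (Measurable.const_div (by fun_prop) _).indicator Metric.isOpen_ball.measurableSet
    have hfin : (∫⁻ v, k v ^ b) ^ (1 / b) ≠ ⊤ :=
      ENNReal.rpow_ne_top_of_nonneg (by positivity) (lintegral_near_kernel_lt_top hM.le hb hb').ne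
    refine ⟨((∫⁻ v, k v ^ b) ^ (1 / b)).toReal + 1, by positivity, ?_⟩
    intro T hT ω hω _ hTL i j
    have hpt (x : E3) : ‖∫ z : E3, ω z • (χ ‖x - T z‖ •
        cross3 (secondPartialKer α (T z) i j x) (svec (T z)))‖ₑ ≤
          ∫⁻ z, ‖ω z‖ₑ * k (x - T z) := by
      refine (enorm_integral_le_lintegral_enorm _).trans (lintegral_mono_ae ?_)
      filter_upwards [hTL] with z hz
      by_cases h0 : ω z = 0
      · simp [h0]
      rw [enorm_smul]
      gcongr
      by_cases hm : x - T z ∈ Metric.ball (0 : E3) 3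
      · rw [hk, Set.indicator_of_mem hm]
        rcases eq_or_ne (x - T z) 0 with hxz | hne
        · have hM' : ENNReal.ofReal (34 / α ^ 2 * L) ≠ 0 := by simpa using hM
          simp [hxz, ENNReal.div_zero hM']
        have hn : 0 < ‖x - T z‖ := norm_pos_iff.mpr hne
        rw [← ofReal_norm (x - T z), ← ENNReal.ofReal_pow hn.le,
          ← ENNReal.ofReal_div_of_pos (by positivity), ← ofReal_norm]
        refine ENNReal.ofReal_le_ofReal ?_
        obtain ⟨hc0, hc1⟩ := hχ01 ‖x - T z‖
        rw [norm_smul, Real.norm_of_nonneg hc0]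
        exact (mul_le_of_le_one_left (norm_nonneg _) hc1).trans
          (norm_cross3_secondPartialKer_svec_le hα hne (hz h0) i j)
      · have : 2 < |‖x - T z‖| := by
          rw [abs_norm]
          rw [mem_ball_zero_iff] at hm
          linarith
        simp [hχ0 _ this]
    have hωn : ∫⁻ z, ‖ω z‖ₑ = ENNReal.ofReal (∫ z, |ω z|) := by
      simpa using (ofReal_integral_norm_eq_lintegral_enorm hω).symm
    rw [eLpNorm_eq_lintegral_rpow_enorm_toReal (by simpa using hb0) ENNReal.ofReal_ne_top,
      ENNReal.toReal_ofReal hb0.le]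
    calc _ ≤ (∫⁻ x, (∫⁻ z, ‖ω z‖ₑ * k (x - T z)) ^ b) ^ (1 / b) := by
          gcongr with x
          exact hpt x
      _ ≤ (∫⁻ z, ‖ω z‖ₑ) * (∫⁻ v, k v ^ b) ^ (1 / b) :=
          lintegral_lintegral_mul_translate_rpow_le volume volume hb hkm hT
            hω.aestronglyMeasurable.enorm
      _ ≤ _ := by
          rw [hωn, mul_comm, ENNReal.ofReal_mul (by positivity)]
          gcongr
          exact (ENNReal.ofReal_toReal hfin).symm.le.trans
            (ENNReal.ofReal_le_ofReal (by linarith))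

end
end
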